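/- Let Λ be a finitely generated free ℤ-module, let V = ℂ ⊗_ℤ Λ, regarded as a ℂ-vector space containing Λ (via λ ↦ 1 ⊗ λ) and containing Λ_ℚ, the image of ℚ ⊗_ℤ Λ in V. Let W ⊆ V be a ℂ-linear subspace with W ∩ Λ_ℚ = {0}. Then the torsion subgroup of the quotient abelian group V/(W + Λ) is isomorphic to Λ ⊗_ℤ (ℚ/ℤ). -/

import Mathlib

open scoped TensorProduct

/-- Let `Λ` be a finitely generated free `ℤ`-module, `V = ℂ ⊗_ℤ Λ`, with `Λ` embedded via
`λ ↦ 1 ⊗ λ` and `Λ_ℚ ⊆ V` the `ℚ`-span of (the image of) `Λ` (i.e. the image of `ℚ ⊗ Λ`).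
If `W ⊆ V` is a `ℂ`-subspace with `W ∩ Λ_ℚ = 0`, then the torsion subgroup of
`V / (W + Λ)` is isomorphic to `Λ ⊗_ℤ (ℚ/ℤ)`. -/
theorem torsion_of_generalized_torus {Λ : Type*} [AddCommGroup Λ] [Module ℤ Λ]
    [Module.Free ℤ Λ] [Module.Finite ℤ Λ]
    (ι : Λ →ₗ[ℤ] ℂ ⊗[ℤ] Λ) (hι : ∀ l : Λ, ι l = (1 : ℂ) ⊗ₜ[ℤ] l)
    (W : Submodule ℂ (ℂ ⊗[ℤ] Λ))
    (hW : ∀ x : ℂ ⊗[ℤ] Λ, x ∈ W →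
      x ∈ Submodule.span ℚ (Set.range ι) → x = 0) :
    Nonempty
      ((Submodule.torsion ℤ
          ((ℂ ⊗[ℤ] Λ) ⧸ (W.toAddSubgroup ⊔ AddMonoidHom.range ι.toAddMonoidHom))) ≃+
        (Λ ⊗[ℤ] (ℚ ⧸ Submodule.span ℤ ({1} : Set ℚ)))) := by
  classical
  rename_i i₁ i₂ i₃ i₄
  obtain rfl : i₂ = AddCommGroup.toIntModule Λ := Subsingleton.elim _ _
  let j : ℚ →ₗ[ℤ] ℂ := (Algebra.linearMap ℚ ℂ).restrictScalars ℤ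
  have hj : Function.Injective j := (algebraMap ℚ ℂ).injective
  let g : Λ ⊗[ℤ] ℚ →ₗ[ℤ] ℂ ⊗[ℤ] Λ :=
    (LinearMap.rTensor Λ j) ∘ₗ (TensorProduct.comm ℤ Λ ℚ).toLinearMap
  have hgt : ∀ (l : Λ) (q : ℚ), g (l ⊗ₜ q) = (q : ℂ) ⊗ₜ[ℤ] l := fun l q => rfl
  have hginj : Function.Injective g :=
    (Module.Flat.rTensor_preserves_injective_linearMap j hj).comp
      (TensorProduct.comm ℤ Λ ℚ).injective
  have hgspan : ∀ x, g x ∈ Submodule.span ℚ (Set.range ι) := by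
    intro x
    induction x using TensorProduct.induction_on with
    | zero => rw [map_zero]; exact zero_mem _
    | add x y hx hy => rw [map_add]; exact add_mem hx hy
    | tmul l q =>
      have : g (l ⊗ₜ q) = q • ι l := by
        rw [hgt, hι, TensorProduct.smul_tmul', Rat.smul_def, mul_one]
      rw [this]
      exact Submodule.smul_mem _ _ (Submodule.subset_span ⟨l, rfl⟩)
  have hg1 : ∀ l : Λ, g (l ⊗ₜ 1) = ι l := by
    intro l
    rw [hgt, hι, Rat.cast_one]
  set H := W.toAddSubgroup ⊔ AddMonoidHom.range ι.toAddMonoidHom with hH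
  let f₀ : Λ ⊗[ℤ] ℚ →+ (ℂ ⊗[ℤ] Λ) ⧸ H := (QuotientAddGroup.mk' H).comp g.toAddMonoidHom
  have hf₀ : ∀ x, f₀ x = QuotientAddGroup.mk' H (g x) := fun x => rfl
  have hιH : ∀ l, ι l ∈ H := fun l =>
    (le_sup_right : _ ≤ H) ⟨l, rfl⟩
  have htors : ∀ x, f₀ x ∈ (Submodule.torsion ℤ ((ℂ ⊗[ℤ] Λ) ⧸ H)).toAddSubgroup := by
    intro x
    induction x using TensorProduct.induction_on with
    | zero => rw [map_zero]; exact zero_mem _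
    | add x y hx hy => rw [map_add]; exact add_mem hx hy
    | tmul l q =>
      have hd : (q.den : ℤ) ≠ 0 := by exact_mod_cast q.den_nz
      refine (Submodule.mem_torsion_iff _).2
        ⟨⟨(q.den : ℤ), mem_nonZeroDivisors_of_ne_zero hd⟩, ?_⟩
      change (q.den : ℤ) • f₀ (l ⊗ₜ q) = 0
      rw [← map_zsmul, hf₀]
      have : (q.den : ℤ) • (l ⊗ₜ[ℤ] q) = (q.num • l) ⊗ₜ[ℤ] (1 : ℚ) := by
        rw [← TensorProduct.tmul_smul, TensorProduct.smul_tmul]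
        congr 1
        rw [zsmul_eq_mul, zsmul_eq_mul, mul_one]
        exact_mod_cast Rat.den_mul_eq_num q
      rw [this, hg1]
      exact (QuotientAddGroup.eq_zero_iff _).2 (hιH _)
  let f : Λ ⊗[ℤ] ℚ →+ (Submodule.torsion ℤ ((ℂ ⊗[ℤ] Λ) ⧸ H)).toAddSubgroup :=
    f₀.codRestrict _ htors
  have hfsurj : Function.Surjective f := by
    rintro ⟨y, hy⟩
    obtain ⟨⟨n, hn⟩, hny⟩ := (Submodule.mem_torsion_iff _).1 hy
    have hn0 : n ≠ 0 := nonZeroDivisors.ne_zero hn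
    obtain ⟨v, rfl⟩ := QuotientAddGroup.mk'_surjective H y
    change n • (QuotientAddGroup.mk' H v) = 0 at hny
    rw [← map_zsmul] at hny
    have hv : n • v ∈ H := (QuotientAddGroup.eq_zero_iff _).1 hny
    obtain ⟨w, hw, z, ⟨l, rfl⟩, hwz⟩ := AddSubgroup.mem_sup.1 hv
    change w + ι l = n • v at hwz
    refine ⟨l ⊗ₜ ((n : ℚ)⁻¹), Subtype.ext ?_⟩
    change f₀ _ = QuotientAddGroup.mk' H v
    rw [hf₀, hgt]
    have hnC : (n : ℂ) ≠ 0 := by exact_mod_cast hn0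
    have hv' : v = (n : ℂ)⁻¹ • w + (((n : ℚ)⁻¹ : ℚ) : ℂ) ⊗ₜ[ℤ] l := by
      have h1 : (((n : ℚ)⁻¹ : ℚ) : ℂ) ⊗ₜ[ℤ] l = (n : ℂ)⁻¹ • ι l := by
        rw [hι, TensorProduct.smul_tmul', smul_eq_mul, mul_one]
        push_cast
        rfl
      rw [h1, ← smul_add, hwz, ← Int.cast_smul_eq_zsmul ℂ n v, smul_smul,
        inv_mul_cancel₀ hnC, one_smul]
    conv_rhs => rw [hv', map_add]
    have : QuotientAddGroup.mk' H ((n : ℂ)⁻¹ • w) = 0 :=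
      (QuotientAddGroup.eq_zero_iff _).2
        ((le_sup_left : _ ≤ H) (W.smul_mem _ hw))
    rw [this, zero_add]
  let p : Λ ⊗[ℤ] ℚ →ₗ[ℤ] Λ ⊗[ℤ] (ℚ ⧸ Submodule.span ℤ ({1} : Set ℚ)) :=
    LinearMap.lTensor Λ (Submodule.span ℤ ({1} : Set ℚ)).mkQ
  have hpsurj : Function.Surjective p :=
    LinearMap.lTensor_surjective Λ (Submodule.mkQ_surjective _)
  have hex : Function.Exact (LinearMap.lTensor Λ (Submodule.span ℤ ({1} : Set ℚ)).subtype) p :=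
    lTensor_exact Λ (LinearMap.exact_subtype_mkQ _) (Submodule.mkQ_surjective _)
  have hker : f.ker = p.toAddMonoidHom.ker := by
    ext x
    have hfx : x ∈ f.ker ↔ g x ∈ H := by
      rw [AddMonoidHom.mem_ker, ← QuotientAddGroup.eq_zero_iff]
      exact Subtype.ext_iff
    have hpx : x ∈ p.toAddMonoidHom.ker ↔ p x = 0 := Iff.rfl
    rw [hfx, hpx]
    constructor
    · intro hx
      obtain ⟨w, hw, z, ⟨l, rfl⟩, hwz⟩ := AddSubgroup.mem_sup.1 hx
      change w + ι l = g x at hwz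
      have hw' : w = g (x - l ⊗ₜ 1) := by
        rw [map_sub, hg1, ← hwz, add_sub_cancel_right]
      have h0 : w = 0 := hW w hw (hw' ▸ hgspan _)
      have hxl : x = l ⊗ₜ 1 := by
        rw [← sub_eq_zero]
        apply hginj
        rw [← hw', h0, map_zero]
      rw [hex x, hxl]
      exact ⟨l ⊗ₜ ⟨1, Submodule.mem_span_singleton_self 1⟩, rfl⟩
    · intro hx
      obtain ⟨y, rfl⟩ := (hex x).1 hx
      clear hx hfx hpx
      induction y using TensorProduct.induction_on with
      | zero => rw [map_zero, map_zero]; exact zero_mem _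
      | add a b ha hb =>
        rw [map_add, map_add]
        exact add_mem ha hb
      | tmul l q =>
        obtain ⟨q, hq⟩ := q
        obtain ⟨m, rfl⟩ := Submodule.mem_span_singleton.1 hq
        have : LinearMap.lTensor Λ (Submodule.span ℤ ({1} : Set ℚ)).subtype
            (l ⊗ₜ ⟨m • (1 : ℚ), hq⟩) = (m • l) ⊗ₜ (1 : ℚ) := by
          rw [TensorProduct.smul_tmul]
          rfl
        rw [this, hg1]
        exact hιH _
  exact ⟨(QuotientAddGroup.quotientKerEquivOfSurjective f hfsurj).symm.trans
    ((QuotientAddGroup.quotientAddEquivOfEq hker).trans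
      (QuotientAddGroup.quotientKerEquivOfSurjective p.toAddMonoidHom hpsurj))⟩
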